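/- (Free evolution implies true evolution, Bernoulli case.) Fix q ∈ (0,1), integers N, k ≥ 1, a_n > 0 for every integer n ≥ 1, and jump parameters β_1, β_2, … > 0. Suppose u : ℤ_{≥0} × ℤ^k → ℝ satisfies: (1) for all t ≥ 0 and all n⃗ ∈ ℤ^k with every coordinate ≥ 1, ([∇_{a_{n_1} β_{t+1}}]_1 ⋯ [∇_{a_{n_k} β_{t+1}}]_k u(t+1;·))(n⃗) = ([∇_{q a_{n_1} β_{t+1}}]_1 ⋯ [∇_{q a_{n_k} β_{t+1}}]_k u(t;·))(n⃗); (2) for all t ≥ 0, every i ∈ {1,…,k−1} and every n⃗ ∈ ℤ^k with n_i = n_{i+1}, ([∇]_i − q [∇]_{i+1}) u(t;n⃗) = 0; (3) u(t;n⃗) = 0 for all t whenever some coordinate of n⃗ is ≤ 0. Define h(t;y⃗) = u(t; n⃗(y⃗)) for y⃗ ∈ Y^N_k. Then for all t ≥ 0 and y⃗ ∈ Y^N_k: (A^{(a_1 β_{t+1})}_1 ⋯ A^{(a_N β_{t+1})}_N h(t+1;·))(y⃗) = (A^{(q a_1 β_{t+1})}_1 ⋯ A^{(q a_N β_{t+1})}_N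 h(t;·))(y⃗) (in each composition the operator with index N is applied first), and h(t;y⃗) = 0 whenever y_0 > 0. -/

import Mathlib

/-- The q-Pochhammer symbol `(a;q)_n = ∏_{i=0}^{n-1} (1 - a q^i)`. -/
noncomputable def qPoch (q a : ℝ) (n : ℕ) : ℝ := ∏ i ∈ Finset.range n, (1 - a * q ^ i)

/-- The coefficients `C_a(y,s)`, with the convention `C_a(y,s) = 0` for `s < 0` or `s > y`. -/
noncomputable def Cco (q a : ℝ) (y : ℕ) (s : ℤ) : ℝ :=
  if 0 ≤ s ∧ s ≤ (y : ℤ) then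
    (-a) ^ s.toNat * qPoch q (-a) (y - s.toNat) *
      (qPoch q q y / (qPoch q q (y - s.toNat) * qPoch q q s.toNat))
  else 0

/-- `([∇]_i f)(n⃗) = f(n⃗ - e_i) - f(n⃗)`. -/
noncomputable def nablaD {k : ℕ} (i : Fin k) (f : (Fin k → ℤ) → ℝ) (n : Fin k → ℤ) : ℝ :=
  f (Function.update n i (n i - 1)) - f n

/-- `([∇_x]_i f)(n⃗) = (1+x) f(n⃗) - x f(n⃗ - e_i)`. -/
noncomputable def nablaX {k : ℕ} (x : ℝ) (i : Fin k) (f : (Fin k → ℤ) → ℝ)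
    (n : Fin k → ℤ) : ℝ :=
  (1 + x) * f n - x * f (Function.update n i (n i - 1))

/-- `y⃗^{s}_{i,i-1}`: move `s` units of mass from coordinate `i+1` (paper index `i+1 ∈ {1,…,N}`)
to coordinate `i` of `y⃗ ∈ Y^N = ℤ_{≥0}^{N+1}`. -/
def moveY {N : ℕ} (y : Fin (N + 1) → ℕ) (i : Fin N) (s : ℕ) : Fin (N + 1) → ℕ :=
  Function.update (Function.update y i.succ (y i.succ - s)) i.castSucc (y i.castSucc + s)

/-- The operator `(A^{(a)}_i f)(y⃗) = ∑_{s=0}^{y_i} C_a(y_i,s) f(y⃗^{s}_{i,i-1})`,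
where `i : Fin N` denotes paper index `i+1`. -/
noncomputable def Aop {N : ℕ} (q a : ℝ) (i : Fin N) (f : (Fin (N + 1) → ℕ) → ℝ)
    (y : Fin (N + 1) → ℕ) : ℝ :=
  ∑ s ∈ Finset.range (y i.succ + 1), Cco q a (y i.succ) (s : ℤ) * f (moveY y i s)

/-- The composition `A^{(c_1)}_1 ⋯ A^{(c_N)}_N f`, with the operator of index `N` applied first. -/
noncomputable def Acomp {N : ℕ} (q : ℝ) (c : Fin N → ℝ) (f : (Fin (N + 1) → ℕ) → ℝ) :
    (Fin (N + 1) → ℕ) → ℝ :=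
  (List.finRange N).foldr (fun i g => Aop q (c i) i g) f

/-- `n⃗(y⃗) ∈ ℤ^k`: the weakly decreasing vector containing exactly `y_v` entries equal to `v`. -/
def nvec (N k : ℕ) (y : Fin (N + 1) → ℕ) (j : Fin k) : ℕ :=
  (Finset.univ.filter
    (fun v : Fin (N + 1) => (j : ℕ) < ∑ i ∈ Finset.Ici v, y i)).sup (fun v => (v : ℕ))

lemma qPoch_succ (q a : ℝ) (n : ℕ) : qPoch q a (n + 1) = qPoch q a n * (1 - a * q ^ n) :=
  Finset.prod_range_succ _ _

lemma qPoch_self_ne_zero {q : ℝ} (hq : q ∈ Set.Ioo (0 : ℝ) 1) (n : ℕ) : qPoch q q n ≠ 0 := by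
  refine Finset.prod_ne_zero_iff.2 fun i _ => ?_
  rw [← pow_succ']
  exact (sub_pos.2 (pow_lt_one₀ hq.1.le hq.2 i.succ_ne_zero)).ne'

lemma Cco_add (q x : ℝ) (d s : ℕ) :
    Cco q x (d + s) (s : ℤ) =
      (-x) ^ s * qPoch q (-x) d * (qPoch q q (d + s) / (qPoch q q d * qPoch q q s)) := by
  have h : (0 : ℤ) ≤ s ∧ (s : ℤ) ≤ ((d + s : ℕ) : ℤ) := by omega
  rw [Cco, if_pos h]
  simp

lemma Cco_eq_zero_of_lt (q x : ℝ) {y s : ℕ} (h : y < s) : Cco q x y (s : ℤ) = 0 :=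
  if_neg (by omega)

lemma Cco_succ_zero {q : ℝ} (hq : q ∈ Set.Ioo (0 : ℝ) 1) (x : ℝ) (y : ℕ) :
    Cco q x (y + 1) ((0 : ℕ) : ℤ) = (1 + x * q ^ y) * Cco q x y ((0 : ℕ) : ℤ) := by
  have h₁ := Cco_add q x (y + 1) 0
  have h₂ := Cco_add q x y 0
  have h₃ := qPoch_self_ne_zero hq y
  have h₄ := qPoch_self_ne_zero hq (y + 1)
  have h₅ := qPoch_self_ne_zero hq 0
  rw [add_zero] at h₁ h₂
  rw [h₁, h₂, qPoch_succ q (-x)]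
  field_simp
  ring

/-- The `q`-Pascal rule for the coefficients `Cco`. -/
lemma Cco_succ_succ {q : ℝ} (hq : q ∈ Set.Ioo (0 : ℝ) 1) (x : ℝ) {y s : ℕ} (hs : s ≤ y) :
    Cco q x (y + 1) ((s + 1 : ℕ) : ℤ) =
      (1 + x * q ^ (y - (s + 1))) * Cco q x y ((s + 1 : ℕ) : ℤ)
        - x * q ^ (y - s) * Cco q x y (s : ℤ) := by
  obtain ⟨d, rfl⟩ := Nat.exists_eq_add_of_le' hs
  have n₁ := qPoch_self_ne_zero hq s
  have n₂ := qPoch_self_ne_zero hq d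
  have n₃ := qPoch_self_ne_zero hq (s + 1)
  rw [Cco_add, add_assoc, Cco_add, Nat.add_sub_cancel]
  rcases d with _ | d
  · rw [Cco_eq_zero_of_lt q x (by omega)]
    simp only [zero_add]
    field_simp
    ring
  · have n₄ := qPoch_self_ne_zero hq d
    have e : d + 1 + s = d + (s + 1) := by omega
    have n₅ : (1 - q * q ^ s) ≠ 0 := fun h => n₃ (by rw [qPoch_succ, h, mul_zero])
    have n₆ : (1 - q * q ^ d) ≠ 0 := fun h => n₂ (by rw [qPoch_succ, h, mul_zero])
    rw [e, Cco_add, Nat.add_sub_cancel, show d + 1 + (s + 1) = d + (s + 1) + 1 by omega]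
    simp only [qPoch_succ q q (d + (s + 1)), qPoch_succ q _ d, qPoch_succ q _ s, pow_add, pow_one]
    generalize q ^ s = S at *
    generalize q ^ d = D at *
    have n₇ : 1 - D * q ≠ 0 := by rwa [mul_comm]
    field_simp
    ring

/-- The product of the operators `∇_{c (n i)}` over all coordinates, acting on functions of
lists. -/
noncomputable def listNabla (c : ℤ → ℝ) : (List ℤ → ℝ) → List ℤ → ℝ
  | F, [] => F []
  | F, m :: l => (1 + c m) * listNabla c (fun r => F (m :: r)) l
      - c m * listNabla c (fun r => F ((m - 1) :: r)) l

lemma listNabla_append (c : ℤ → ℝ) (l r : List ℤ) (F : List ℤ → ℝ) :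
    listNabla c F (l ++ r) = listNabla c (fun l' => listNabla c (fun r' => F (l' ++ r')) r) l := by
  induction l generalizing F with
  | nil => simp [listNabla]
  | cons m l ih => simp [listNabla, ih]

lemma listNabla_sum {ι : Type*} (c : ℤ → ℝ) (S : Finset ι) (w : ι → ℝ) (F : ι → List ℤ → ℝ)
    (l : List ℤ) :
    listNabla c (fun r => ∑ s ∈ S, w s * F s r) l = ∑ s ∈ S, w s * listNabla c (F s) l := by
  induction l generalizing F with
  | nil => rfl
  | cons m l ih =>
    simp only [listNabla, ih, Finset.mul_sum, ← Finset.sum_sub_distrib]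
    exact Finset.sum_congr rfl fun _ _ => by ring

/-- The two-body boundary condition for functions of lists. -/
def ListBoundary (q : ℝ) (F : List ℤ → ℝ) : Prop :=
  ∀ (p r : List ℤ) (m : ℤ), F (p ++ (m - 1) :: m :: r) =
    q * F (p ++ m :: (m - 1) :: r) + (1 - q) * F (p ++ m :: m :: r)

lemma ListBoundary.append_left {q : ℝ} {F : List ℤ → ℝ} (hF : ListBoundary q F) (l : List ℤ) :
    ListBoundary q fun r => F (l ++ r) := fun p r m => by
  simpa using hF (l ++ p) r m

lemma ListBoundary.append_right {q : ℝ} {F : List ℤ → ℝ} (hF : ListBoundary q F) (l : List ℤ) :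
    ListBoundary q fun r => F (r ++ l) := fun p r m => by
  simpa using hF p (r ++ l) m

lemma ListBoundary.pred_cons_replicate {q : ℝ} {F : List ℤ → ℝ} (hF : ListBoundary q F) (m : ℤ)
    (j : ℕ) (r : List ℤ) :
    F ((m - 1) :: (List.replicate j m ++ r)) =
      q ^ j * F (List.replicate j m ++ (m - 1) :: r)
        + (1 - q ^ j) * F (List.replicate (j + 1) m ++ r) := by
  induction j generalizing F with
  | zero => simp
  | succ j ih =>
    have h₁ := hF [] (List.replicate j m ++ r) m
    have h₂ := ih (hF.append_left [m])
    simp only [List.nil_append, List.cons_append, List.replicate_succ] at h₁ h₂ ⊢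
    rw [h₁, h₂]
    ring

lemma listNabla_replicate {q : ℝ} (hq : q ∈ Set.Ioo (0 : ℝ) 1) (c : ℤ → ℝ) (m : ℤ) (y : ℕ)
    {F : List ℤ → ℝ} (hF : ListBoundary q F) :
    listNabla c F (List.replicate y m) =
      ∑ s ∈ Finset.range (y + 1), Cco q (c m) y (s : ℤ) *
        F (List.replicate (y - s) m ++ List.replicate s (m - 1)) := by
  induction y generalizing F with
  | zero =>
    have h := Cco_add q (c m) 0 0
    simp only [Nat.cast_zero, add_zero] at h
    simp [listNabla, h, qPoch]
  | succ y ih =>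
    set x := c m
    set g : ℕ → ℝ := fun s => F (List.replicate (y + 1 - s) m ++ List.replicate s (m - 1)) with hg
    have key : listNabla c F (List.replicate (y + 1) m) =
        ∑ s ∈ Finset.range (y + 1), ((1 + x * q ^ (y - s)) * Cco q x y (s : ℤ) * g s
          - x * q ^ (y - s) * Cco q x y (s : ℤ) * g (s + 1)) := by
      have h₁ := ih (hF.append_left [m])
      have h₂ := ih (hF.append_left [m - 1])
      simp only [List.cons_append, List.nil_append] at h₁ h₂
      rw [List.replicate_succ, listNabla, h₁, h₂, Finset.mul_sum, Finset.mul_sum,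
        ← Finset.sum_sub_distrib]
      refine Finset.sum_congr rfl fun s hs => ?_
      have hs' : s ≤ y := Nat.lt_succ_iff.1 (Finset.mem_range.1 hs)
      have e₁ : y + 1 - s = y - s + 1 := by omega
      have e₂ : y + 1 - (s + 1) = y - s := by omega
      rw [hF.pred_cons_replicate, hg]
      simp only [e₁, e₂, List.replicate_succ, List.cons_append]
      ring
    have step : ∀ s ∈ Finset.range (y + 1), Cco q x (y + 1) ((s + 1 : ℕ) : ℤ) * g (s + 1) =
        (1 + x * q ^ (y - (s + 1))) * Cco q x y ((s + 1 : ℕ) : ℤ) * g (s + 1)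
          - x * q ^ (y - s) * Cco q x y (s : ℤ) * g (s + 1) := fun s hs => by
      rw [Cco_succ_succ hq x (Nat.lt_succ_iff.1 (Finset.mem_range.1 hs)), sub_mul]
    have shift := (Finset.sum_range_succ' (fun s : ℕ =>
      (1 + x * q ^ (y - s)) * Cco q x y (s : ℤ) * g s) (y + 1)).symm.trans
        (Finset.sum_range_succ _ (y + 1))
    rw [Cco_eq_zero_of_lt q x (Nat.lt_succ_self y), mul_zero, zero_mul, add_zero,
      Nat.sub_zero] at shift
    change _ = ∑ s ∈ Finset.range (y + 1 + 1), Cco q x (y + 1) (s : ℤ) * g s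
    rw [key, Finset.sum_range_succ' _ (y + 1), Finset.sum_congr rfl step, Finset.sum_sub_distrib,
      Finset.sum_sub_distrib, Cco_succ_zero hq, ← shift]
    ring

lemma moveY_cons_succ {N : ℕ} (b : ℕ) (y : Fin (N + 1) → ℕ) (i : Fin N) (s : ℕ) :
    moveY (Fin.cons b y : Fin (N + 2) → ℕ) i.succ s = Fin.cons b (moveY y i s) := by
  simp only [moveY, Fin.cons_succ, ← Fin.succ_castSucc, Fin.cons_update]

lemma moveY_cons_cons_zero {N : ℕ} (b d : ℕ) (y : Fin N → ℕ) (s : ℕ) :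
    moveY (Fin.cons b (Fin.cons d y : Fin (N + 1) → ℕ) : Fin (N + 2) → ℕ) 0 s =
      Fin.cons (b + s) (Fin.cons (d - s) y : Fin (N + 1) → ℕ) := by
  simp only [moveY, Fin.cons_succ, Fin.castSucc_zero, Fin.cons_zero, ← Fin.cons_update,
    Fin.update_cons_zero]

lemma foldr_Aop_succ {N : ℕ} (q : ℝ) (c : Fin (N + 1) → ℝ) (L : List (Fin N)) (b : ℕ)
    (f : (Fin (N + 2) → ℕ) → ℝ) (y : Fin (N + 1) → ℕ) :
    L.foldr (fun i g => Aop q (c i.succ) i.succ g) f (Fin.cons b y) =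
      L.foldr (fun i g => Aop q (c i.succ) i g) (fun y' => f (Fin.cons b y')) y := by
  induction L generalizing y with
  | nil => rfl
  | cons i L ih => simp only [List.foldr_cons, Aop, Fin.cons_succ, moveY_cons_succ, ih]

lemma Acomp_succ {N : ℕ} (q : ℝ) (c : Fin (N + 1) → ℝ) (b d : ℕ)
    (f : (Fin (N + 2) → ℕ) → ℝ) (y : Fin N → ℕ) :
    Acomp q c f (Fin.cons b (Fin.cons d y : Fin (N + 1) → ℕ)) =
      ∑ s ∈ Finset.range (d + 1), Cco q (c 0) d (s : ℤ) *
        Acomp q (fun i => c i.succ) (fun y' => f (Fin.cons (b + s) y'))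
          (Fin.cons (d - s) y) := by
  simp only [Acomp, List.finRange_succ, List.foldr_cons, List.foldr_map]
  simp only [Aop, Fin.cons_succ, Fin.cons_zero, moveY_cons_cons_zero]
  exact Finset.sum_congr rfl fun s _ => by rw [← foldr_Aop_succ]

/-- The weakly decreasing list with `y i` entries equal to `v + i`. -/
def decrList : (M : ℕ) → ℤ → (Fin M → ℕ) → List ℤ
  | 0, _, _ => []
  | M + 1, v, y => decrList M (v + 1) (Fin.tail y) ++ List.replicate (y 0) v

lemma listNabla_decrList {q : ℝ} (hq : q ∈ Set.Ioo (0 : ℝ) 1) (c : ℤ → ℝ) {N : ℕ} (b : ℕ)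
    (y : Fin N → ℕ) (v : ℤ) {F : List ℤ → ℝ} (hF : ListBoundary q F) :
    listNabla c (fun l => F (l ++ List.replicate b v)) (decrList N (v + 1) y) =
      Acomp q (fun i : Fin N => c (v + 1 + (i : ℕ))) (fun y' => F (decrList (N + 1) v y'))
        (Fin.cons b y) := by
  induction N generalizing b v F with
  | zero => simp [decrList, listNabla, Acomp]
  | succ N ih =>
    induction y using Fin.consCases with
    | _ d y =>
    rw [Acomp_succ, decrList, listNabla_append]
    simp only [Fin.tail_cons, Fin.cons_zero]
    have h (l' : List ℤ) := listNabla_replicate hq c (v + 1) d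
      ((hF.append_right (List.replicate b v)).append_left l')
    simp only [h, listNabla_sum]
    refine Finset.sum_congr (by simp) fun s _ => ?_
    have h₂ := ih (d - s) y (v + 1) (hF.append_right (List.replicate (b + s) v))
    simp only [Fin.val_zero, Nat.cast_zero, add_zero]
    congr 1
    convert h₂ using 2
    · rw [add_sub_cancel_right, add_comm b s, List.replicate_add]
      simp
    · funext i
      simp only [Fin.val_succ]
      push_cast
      ring_nf
    · funext y'
      simp [decrList]

lemma foldr_nablaX_succ {k : ℕ} (w : Fin (k + 1) → ℝ) (L : List (Fin k)) (m : ℤ)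
    (f : (Fin (k + 1) → ℤ) → ℝ) (n : Fin k → ℤ) :
    L.foldr (fun i g => nablaX (w i.succ) i.succ g) f (Fin.cons m n) =
      L.foldr (fun i g => nablaX (w i.succ) i g) (fun n' => f (Fin.cons m n')) n := by
  induction L generalizing n with
  | nil => rfl
  | cons i L ih => simp only [List.foldr_cons, nablaX, Fin.cons_succ, ← Fin.cons_update, ih]

lemma foldr_nablaX_eq_listNabla (c : ℤ → ℝ) {k : ℕ} (F : List ℤ → ℝ) (n : Fin k → ℤ) :
    (List.finRange k).foldr (fun i g => nablaX (c (n i)) i g) (fun n' => F (List.ofFn n')) n =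
      listNabla c F (List.ofFn n) := by
  induction k generalizing F with
  | zero => simp [listNabla]
  | succ k ih =>
    induction n using Fin.consCases with
    | _ m n =>
    simp only [List.finRange_succ, List.foldr_cons, List.foldr_map, nablaX, Fin.update_cons_zero,
      Fin.cons_zero]
    have h := foldr_nablaX_succ (fun i => c ((Fin.cons m n : Fin (k + 1) → ℤ) i)) (List.finRange k)
    simp only [Fin.cons_succ] at h ⊢
    simp only [h, List.ofFn_cons, listNabla]
    rw [ih (fun l => F (m :: l)), ih (fun l => F ((m - 1) :: l))]

/-- A function on `ℤ^k` seen as a function on lists, extended by zero. -/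
noncomputable def listExtend {k : ℕ} (f : (Fin k → ℤ) → ℝ) (l : List ℤ) : ℝ :=
  if l.length = k then f (fun j => l.getD j 0) else 0

lemma listExtend_ofFn {k : ℕ} (f : (Fin k → ℤ) → ℝ) (n : Fin k → ℤ) :
    listExtend f (List.ofFn n) = f n := by
  simp [listExtend]

lemma update_getD_append (k : ℕ) (p r : List ℤ) (b d : ℤ) (h : p.length < k) :
    Function.update (fun j : Fin k => (p ++ b :: r).getD j 0) ⟨p.length, h⟩ d =
      fun j : Fin k => (p ++ d :: r).getD j 0 := by
  funext j
  simp only [Function.update_apply, Fin.ext_iff]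
  rcases lt_trichotomy (j : ℕ) p.length with hj | hj | hj
  · rw [if_neg hj.ne, List.getD_append _ _ _ _ hj, List.getD_append _ _ _ _ hj]
  · simp [hj]
  · obtain ⟨e, he⟩ := Nat.exists_eq_add_of_lt hj
    rw [if_neg hj.ne', List.getD_append_right _ _ _ _ hj.le, List.getD_append_right _ _ _ _ hj.le,
      he, add_assoc, Nat.add_sub_cancel_left, List.getD_cons_succ, List.getD_cons_succ]

lemma listBoundary_listExtend {q : ℝ} {k : ℕ} {f : (Fin k → ℤ) → ℝ}
    (hf : ∀ (i : ℕ) (hi : i + 1 < k) (n : Fin k → ℤ), n ⟨i, by omega⟩ = n ⟨i + 1, hi⟩ →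
      nablaD ⟨i, by omega⟩ f n - q * nablaD ⟨i + 1, hi⟩ f n = 0) :
    ListBoundary q (listExtend f) := by
  intro p r m
  by_cases hk : p.length + (r.length + 1 + 1) = k
  · have h := hf p.length (by omega) (fun j => (p ++ m :: m :: r).getD j 0) (by simp)
    have e₁ := update_getD_append k p (m :: r) m (m - 1) (by omega)
    have e₂ := update_getD_append k (p ++ [m]) r m (m - 1) (by simp; omega)
    simp only [List.append_assoc, List.cons_append, List.nil_append, List.length_append,
      List.length_singleton] at e₂
    have e₃ : (p ++ m :: m :: r).getD p.length 0 = m := by simp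
    have e₄ : (p ++ m :: m :: r).getD (p.length + 1) 0 = m := by simp
    simp only [nablaD, e₃, e₄, e₁, e₂] at h
    simp only [listExtend, List.length_append, List.length_cons, hk, if_true]
    linarith
  · simp [listExtend, hk]

lemma sum_moveY {N : ℕ} (y : Fin (N + 1) → ℕ) (i : Fin N) {s : ℕ} (hs : s ≤ y i.succ) :
    ∑ v, moveY y i s v = ∑ v, y v := by
  have h : i.succ ∈ Finset.univ \ {i.castSucc} := by
    simpa using (Fin.castSucc_lt_succ (i := i)).ne'
  have e := Finset.sum_update_of_mem (Finset.mem_univ i.castSucc) y (y i.castSucc)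
  have e' := Finset.sum_update_of_mem h y (y i.succ)
  rw [Function.update_eq_self] at e e'
  rw [moveY, Finset.sum_update_of_mem (Finset.mem_univ _), Finset.sum_update_of_mem h, e, e']
  omega

lemma Acomp_congr_of_invariant {N : ℕ} (q : ℝ) (c : Fin N → ℝ) {P : (Fin (N + 1) → ℕ) → Prop}
    (hP : ∀ (y : Fin (N + 1) → ℕ) (i : Fin N) (s : ℕ), s ≤ y (Fin.succ i) → P y → P (moveY y i s)) {f g : (Fin (N + 1) → ℕ) → ℝ}
    (hfg : ∀ y, P y → f y = g y) {y : Fin (N + 1) → ℕ} (hy : P y) :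
    Acomp q c f y = Acomp q c g y := by
  unfold Acomp
  induction List.finRange N generalizing y with
  | nil => exact hfg y hy
  | cons i L ih =>
    rw [List.foldr_cons, List.foldr_cons, Aop, Aop]
    refine Finset.sum_congr rfl fun s hs => ?_
    rw [ih (hP y i s (Nat.lt_succ_iff.1 (Finset.mem_range.1 hs)) hy)]

lemma Acomp_zero {N : ℕ} (q : ℝ) (c : Fin N → ℝ) (y : Fin (N + 1) → ℕ) :
    Acomp q c (fun _ => 0) y = 0 := by
  unfold Acomp
  induction List.finRange N generalizing y with
  | nil => rfl
  | cons i L ih => simp [Aop, ih]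

lemma length_decrList {M : ℕ} (v : ℤ) (y : Fin M → ℕ) : (decrList M v y).length = ∑ i, y i := by
  induction M generalizing v with
  | zero => simp [decrList]
  | succ M ih => simp [decrList, ih, Fin.sum_univ_succ, Fin.tail, add_comm]

lemma sum_Ici_succ_cons {N : ℕ} (b : ℕ) (y : Fin N → ℕ) (v : Fin N) :
    ∑ i ∈ Finset.Ici v.succ, (Fin.cons b y : Fin (N + 1) → ℕ) i = ∑ i ∈ Finset.Ici v, y i := by
  rw [← Fin.map_succEmb_Ici, Finset.sum_map]
  simp

lemma nvec_cons_of_lt {N k : ℕ} (b : ℕ) (y : Fin (N + 1) → ℕ) (j : Fin k)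
    (hj : (j : ℕ) < ∑ i, y i) :
    nvec (N + 1) k (Fin.cons b y) j = nvec N k y j + 1 := by
  apply le_antisymm
  · refine Finset.sup_le fun v hv => ?_
    induction v using Fin.cases with
    | zero => simp
    | succ v =>
      rw [Finset.mem_filter, sum_Ici_succ_cons] at hv
      rw [Fin.val_succ]
      exact Nat.succ_le_succ (Finset.le_sup (f := fun v : Fin (N + 1) => (v : ℕ))
        (Finset.mem_filter.2 ⟨Finset.mem_univ v, hv.2⟩))
  · have hne : (Finset.univ.filter
        (fun v : Fin (N + 1) => (j : ℕ) < ∑ i ∈ Finset.Ici v, y i)).Nonempty :=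
      ⟨0, Finset.mem_filter.2 ⟨Finset.mem_univ _, by
        rwa [← bot_eq_zero, Finset.Ici_bot]⟩⟩
    obtain ⟨v, hv, he⟩ := Finset.exists_mem_eq_sup _ hne fun v : Fin (N + 1) => (v : ℕ)
    rw [nvec, he, ← Fin.val_succ]
    refine Finset.le_sup (f := fun v : Fin (N + 2) => (v : ℕ))
      (Finset.mem_filter.2 ⟨Finset.mem_univ _, ?_⟩)
    rw [sum_Ici_succ_cons]
    exact (Finset.mem_filter.1 hv).2

lemma nvec_cons_of_le {N k : ℕ} (b : ℕ) (y : Fin N → ℕ) (j : Fin k)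
    (hj : ∑ i, y i ≤ (j : ℕ)) :
    nvec N k (Fin.cons b y) j = 0 := by
  refine Nat.le_zero.1 (Finset.sup_le fun v hv => ?_)
  induction v using Fin.cases with
  | zero => simp
  | succ v =>
    rw [Finset.mem_filter, sum_Ici_succ_cons] at hv
    have := Finset.sum_le_univ_sum_of_nonneg (s := Finset.Ici v) (f := y) fun _ => Nat.zero_le _
    omega

lemma getD_decrList {N k : ℕ} (v : ℤ) (y : Fin (N + 1) → ℕ) (j : Fin k)
    (hj : (j : ℕ) < ∑ i, y i) :
    (decrList (N + 1) v y).getD j 0 = v + nvec N k y j := by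
  have tail_le {N : ℕ} (v : ℤ) (b : ℕ) (y : Fin N → ℕ) (h : ∑ i, y i ≤ (j : ℕ))
      (hj : (j : ℕ) < b + ∑ i, y i) :
      (decrList (N + 1) v (Fin.cons b y)).getD j 0 = v + nvec N k (Fin.cons b y) j := by
    rw [nvec_cons_of_le b y j h, decrList, Fin.tail_cons, Fin.cons_zero,
      List.getD_append_right _ _ _ _ (by rwa [length_decrList]), length_decrList,
      List.getD_replicate _ (by omega)]
    simp
  induction N generalizing v with
  | zero =>
    induction y using Fin.consCases with
    | _ b y => exact tail_le v b y (by simp) (by simpa using hj)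
  | succ N ih =>
    induction y using Fin.consCases with
    | _ b y =>
    rw [Fin.sum_univ_succ] at hj
    simp only [Fin.cons_zero, Fin.cons_succ] at hj
    rcases le_or_gt (∑ i, y i) j with h | h
    · exact tail_le v b y h hj
    · rw [nvec_cons_of_lt b y j h, decrList, Fin.tail_cons,
        List.getD_append _ _ _ _ (by rwa [length_decrList]), ih (v + 1) y h]
      push_cast
      ring

lemma ofFn_nvec {N k : ℕ} {y : Fin (N + 1) → ℕ} (hy : ∑ i, y i = k) :
    List.ofFn (fun j => (nvec N k y j : ℤ)) = decrList (N + 1) 0 y := by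
  refine List.ext_getElem (by simp [length_decrList, hy]) fun j h₁ h₂ => ?_
  rw [length_decrList, hy] at h₂
  have h := getD_decrList 0 y (⟨j, h₂⟩ : Fin k) (by simpa [hy] using h₂)
  rw [List.getElem_ofFn, ← List.getD_eq_getElem _ 0, h, zero_add]

lemma foldr_nablaX_nvec {q : ℝ} (hq : q ∈ Set.Ioo (0 : ℝ) 1) {N k : ℕ} (c : ℤ → ℝ)
    {f : (Fin k → ℤ) → ℝ}
    (hf : ∀ (i : ℕ) (hi : i + 1 < k) (n : Fin k → ℤ), n ⟨i, by omega⟩ = n ⟨i + 1, hi⟩ →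
      nablaD ⟨i, by omega⟩ f n - q * nablaD ⟨i + 1, hi⟩ f n = 0)
    {y : Fin (N + 1) → ℕ} (hy : ∑ i, y i = k) (hy0 : y 0 = 0) :
    (List.finRange k).foldr (fun i g => nablaX (c (nvec N k y i)) i g) f
        (fun j => (nvec N k y j : ℤ)) =
      Acomp q (fun i => c ((i : ℕ) + 1)) (fun y' => f (fun j => (nvec N k y' j : ℤ))) y := by
  have h₁ := foldr_nablaX_eq_listNabla c (listExtend f) (fun j => (nvec N k y j : ℤ))
  simp only [listExtend_ofFn] at h₁
  have h₂ := listNabla_decrList hq c (y 0) (Fin.tail y) 0 (listBoundary_listExtend hf)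
  rw [h₁, ofFn_nvec hy, decrList, hy0]
  rw [Fin.cons_self_tail, hy0] at h₂
  simp only [List.replicate_zero, List.append_nil] at h₂ ⊢
  rw [h₂]
  simp only [zero_add, add_comm (1 : ℤ)]
  refine Acomp_congr_of_invariant q _ (P := fun y' => ∑ i, y' i = k)
    (fun y' i s hs h => (sum_moveY y' i hs).trans h) (fun y' h => ?_) hy
  rw [← ofFn_nvec h, listExtend_ofFn]

theorem stmt_11 (q : ℝ) (hq : q ∈ Set.Ioo (0:ℝ) 1) (N k : ℕ) (hN : 1 ≤ N) (hk : 1 ≤ k)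
    (a : ℤ → ℝ) (ha : ∀ n : ℤ, 1 ≤ n → 0 < a n)
    (β : ℕ → ℝ) (hβ : ∀ s : ℕ, 1 ≤ s → 0 < β s)
    (u : ℕ → (Fin k → ℤ) → ℝ)
    (h1 : ∀ t : ℕ, ∀ n : Fin k → ℤ, (∀ i, 1 ≤ n i) →
      ((List.finRange k).foldr (fun i g => nablaX (a (n i) * β (t + 1)) i g) (u (t + 1))) n
        = ((List.finRange k).foldr (fun i g => nablaX (q * (a (n i) * β (t + 1))) i g) (u t)) n)
    (h2 : ∀ t : ℕ, ∀ (i : ℕ) (hi : i + 1 < k) (n : Fin k → ℤ),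
      n ⟨i, by omega⟩ = n ⟨i + 1, hi⟩ →
      nablaD ⟨i, by omega⟩ (u t) n - q * nablaD ⟨i + 1, hi⟩ (u t) n = 0)
    (h3 : ∀ t : ℕ, ∀ n : Fin k → ℤ, (∃ i, n i ≤ 0) → u t n = 0) :
    ∀ t : ℕ, ∀ y : Fin (N + 1) → ℕ, (∑ v, y v) = k →
      (Acomp q (fun i => a ((i : ℕ) + 1) * β (t + 1))
          (fun y' => u (t + 1) (fun j => (nvec N k y' j : ℤ))) y
        = Acomp q (fun i => q * (a ((i : ℕ) + 1) * β (t + 1)))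
            (fun y' => u t (fun j => (nvec N k y' j : ℤ))) y)
      ∧ (0 < y 0 → u t (fun j => (nvec N k y j : ℤ)) = 0) := by
  have hlast (t : ℕ) (y : Fin (N + 1) → ℕ) (hy : ∑ v, y v = k) (h0 : 0 < y 0) :
      u t (fun j => (nvec N k y j : ℤ)) = 0 := by
    refine h3 t _ ⟨⟨k - 1, by omega⟩, ?_⟩
    have hs := Fin.sum_univ_succ y
    have h := nvec_cons_of_le (y 0) (Fin.tail y) (⟨k - 1, by omega⟩ : Fin k) (by
      simp only [Fin.tail]; omega)
    rw [Fin.cons_self_tail] at h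
    rw [h, Nat.cast_zero]
  intro t y hy
  refine ⟨?_, hlast t y hy⟩
  rcases Nat.eq_zero_or_pos (y 0) with h0 | h0
  · rw [← foldr_nablaX_nvec hq (fun m => a m * β (t + 1)) (h2 (t + 1)) hy h0,
      ← foldr_nablaX_nvec hq (fun m => q * (a m * β (t + 1))) (h2 t) hy h0]
    refine h1 t _ fun j => ?_
    obtain ⟨M, rfl⟩ := Nat.exists_eq_add_of_le' hN
    have hs := Fin.sum_univ_succ y
    have h := nvec_cons_of_lt (y 0) (Fin.tail y) j (by simp only [Fin.tail]; omega)
    rw [Fin.cons_self_tail] at h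
    rw [h]
    push_cast
    omega
  · have hz (τ : ℕ) (c : Fin N → ℝ) :
        Acomp q c (fun y' => u τ (fun j => (nvec N k y' j : ℤ))) y = 0 :=
      (Acomp_congr_of_invariant q c (P := fun y' => ∑ i, y' i = k ∧ 0 < y' 0)
        (fun y' i s hs h => ⟨(sum_moveY y' i hs).trans h.1, by
          refine h.2.trans_le ?_
          simp only [moveY, Function.update_apply, (Fin.succ_ne_zero i).symm, if_false]
          split_ifs with h0
          · rw [← h0]
            omega
          · exact le_rfl⟩) (fun y' h => hlast τ y' h.1 h.2) ⟨hy, h0⟩).trans (Acomp_zero q c y)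
    rw [hz, hz]
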